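/- (Lemma 4.3(iii).) Let (u*, p*) be a saddle point of L on U × C* with ‖p*‖ ≤ μ. Let u^k ∈ U, p^k ∈ C* with ‖p^k‖ ≤ μ, q^k = Π(p^k + γΘ(u^k)), and suppose 0 < ε^{k+1} ≤ ε^k ≤ ε⁰ < Nβ/(N B_G + γτ²). For each i let u^{k+1,i} be the SPDC block update with block i and step ε^k and p^{k+1,i} = 𝒫_μ(Π(p^k + γΘ(u^{k+1,i}))). With Λ^ε(u,p) = D(u*,u) + (ε/(2γN))‖p* − p‖² + ε(L(u,p*) − L(u*,p*)), for every subgradient r^k ∈ ∂J(u^k) and h₁ = (2τ/β)(‖q^k − p*‖ + ‖p* − p^k‖/N)(‖∇G(u^k)‖ + ‖r^k‖ + τ‖q^k‖), one has (ε^k/N)[L_γ(u^k, p*) − L_γ(u*, p*)] ≤ Λ^{ε^k}(u^k, p^k) − (1/N)∑_{i=1}^N Λ^{ε^{k+1}}(u^{k+1,i}, p^{k+1,i}) + (ε^k/(γN))‖q^k − p^k‖² + (ε⁰γτ²/N)·(1/N)∑_{i=1}^N ‖u^k − u^{k+1,i}‖² + h₁·(ε^k)². -/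

import Mathlib

open RealInnerProductSpace

/-- The ambient product space `ℝ^n = ℝ^{n_1} × … × ℝ^{n_N}` with the Euclidean
(ℓ²) product structure. -/
abbrev BlockSpace {N : ℕ} (nd : Fin N → ℕ) :=
  PiLp 2 (fun i : Fin N => EuclideanSpace ℝ (Fin (nd i)))

section HilbertSpace

variable {E : Type*} [NormedAddCommGroup E] [InnerProductSpace ℝ E]

/-- A map satisfying the variational characterisation of a projection is nonexpansive. -/
theorem norm_sub_le_of_variational {S : Set E} {P : E → E} (hmem : ∀ x, P x ∈ S)
    (hchar : ∀ x, ∀ q ∈ S, ⟪q - P x, x - P x⟫ ≤ 0) (a b : E) :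
    ‖P a - P b‖ ≤ ‖a - b‖ := by
  have h1 := hchar a (P b) (hmem b)
  have h2 := hchar b (P a) (hmem a)
  have h3 : ⟪P b - P a, a - P a⟫ + ⟪P a - P b, b - P b⟫
      = ‖P a - P b‖ ^ 2 - ⟪P a - P b, a - b⟫ := by
    rw [← real_inner_self_eq_norm_sq]
    simp only [inner_sub_left, inner_sub_right]
    ring
  have h4 := real_inner_le_norm (P a - P b) (a - b)
  by_contra! h
  nlinarith [norm_nonneg (a - b), norm_nonneg (P a - P b)]

/-- Truncating to the ball of radius `μ` does not increase the distance to a point of the ball. -/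
theorem norm_sub_min_smul_le {p y : E} {μ : ℝ} (hp : ‖p‖ ≤ μ) :
    ‖p - min 1 (μ / ‖y‖) • y‖ ≤ ‖p - y‖ := by
  rcases eq_or_ne y 0 with rfl | hy
  · simp
  have hy' : 0 < ‖y‖ := norm_pos_iff.2 hy
  rcases le_total 1 (μ / ‖y‖) with h | h
  · simp [min_eq_left h]
  rw [min_eq_right h]
  obtain ⟨s, hs⟩ : ∃ s, s = μ / ‖y‖ := ⟨_, rfl⟩
  have hμ : μ = s * ‖y‖ := by rw [hs]; field_simp
  rw [← hs] at h ⊢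
  rw [← sq_le_sq₀ (norm_nonneg _) (norm_nonneg _), norm_sub_sq_real, norm_sub_sq_real,
    inner_smul_right, norm_smul, mul_pow, Real.norm_eq_abs, sq_abs]
  have h1 : ⟪p, y⟫ ≤ s * ‖y‖ * ‖y‖ :=
    (real_inner_le_norm p y).trans (by rw [← hμ]; gcongr)
  nlinarith [mul_le_mul_of_nonneg_left h1 (sub_nonneg.2 h),
    mul_nonneg (sq_nonneg (1 - s)) (sq_nonneg ‖y‖)]

theorem two_mul_inner_sub_le (z q p r : E) :
    2 * ⟪z - q, q - p⟫ - ‖z - r‖ ^ 2 ≤ ‖r - p‖ ^ 2 - ‖r - q‖ ^ 2 := by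
  have h : ‖r - p‖ ^ 2 - ‖r - q‖ ^ 2 - (2 * ⟪z - q, q - p⟫ - ‖z - r‖ ^ 2)
      = ‖(z - r) - (q - p)‖ ^ 2 := by
    simp only [← real_inner_self_eq_norm_sq, inner_sub_left, inner_sub_right]
    rw [real_inner_comm r z, real_inner_comm q z, real_inner_comm p z, real_inner_comm q r,
      real_inner_comm p r, real_inner_comm p q]
    ring
  nlinarith [sq_nonneg ‖(z - r) - (q - p)‖]

variable [CompleteSpace E]

theorem HasGradientAt.hasDerivAt_comp_add_smul {f : E → ℝ} {f' x v : E} {t : ℝ}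
    (h : HasGradientAt f f' (x + t • v)) :
    HasDerivAt (fun s : ℝ => f (x + s • v)) ⟪f', v⟫ t := by
  have h1 : HasDerivAt (fun s : ℝ => x + s • v) v t := by
    simpa using ((hasDerivAt_id t).smul_const v).const_add x
  simpa [Function.comp_def] using h.hasFDerivAt.comp_hasDerivAt t h1

theorem ConvexOn.inner_gradient_le_sub {f : E → ℝ} {f' x : E} (hf : ConvexOn ℝ Set.univ f)
    (h : HasGradientAt f f' x) (y : E) : ⟪f', y - x⟫ ≤ f y - f x := by
  have hd : HasDerivAt (fun s : ℝ => f (x + s • (y - x))) ⟪f', y - x⟫ 0 :=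
    HasGradientAt.hasDerivAt_comp_add_smul (by simpa using h)
  have hs := hd.tendsto_slope_zero_right
  refine le_of_tendsto hs ?_
  filter_upwards [Ioo_mem_nhdsGT (zero_lt_one' ℝ)] with t ht
  have hc := hf.2 (Set.mem_univ x) (Set.mem_univ y) (sub_nonneg.2 ht.2.le) ht.1.le (by ring)
  have he : x + (0 + t) • (y - x) = (1 - t) • x + t • y := by module
  simp only [he, zero_smul, add_zero, smul_eq_mul] at hc ⊢
  rw [inv_mul_le_iff₀ ht.1]
  linarith

/-- The descent lemma for a function with Lipschitz gradient. -/
theorem le_add_inner_add_of_gradient_lipschitz {f : E → ℝ} {f' : E → E} {B : ℝ}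
    (h : ∀ x, HasGradientAt f (f' x) x) (hB : ∀ x y, ‖f' x - f' y‖ ≤ B * ‖x - y‖) (x y : E) :
    f y ≤ f x + ⟪f' x, y - x⟫ + B / 2 * ‖y - x‖ ^ 2 := by
  have hd (t : ℝ) : HasDerivAt
      (fun s : ℝ => f (x + s • (y - x)) - s * ⟪f' x, y - x⟫ - s ^ 2 * (B / 2 * ‖y - x‖ ^ 2))
      (⟪f' (x + t • (y - x)), y - x⟫ - ⟪f' x, y - x⟫ - 2 * t * (B / 2 * ‖y - x‖ ^ 2)) t := by
    have h1 := (HasGradientAt.hasDerivAt_comp_add_smul (h (x + t • (y - x))))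
    have h2 := (hasDerivAt_id t).mul_const ⟪f' x, y - x⟫
    have h3 := (hasDerivAt_pow 2 t).mul_const (B / 2 * ‖y - x‖ ^ 2)
    exact ((h1.sub h2).sub h3).congr_deriv (by simp)
  have hanti := antitoneOn_of_deriv_nonpos (convex_Icc (0 : ℝ) 1)
    (fun t _ => (hd t).continuousAt.continuousWithinAt)
    (fun t _ => (hd t).differentiableAt.differentiableWithinAt) (by
      intro t ht
      rw [interior_Icc] at ht
      rw [(hd t).deriv, ← inner_sub_left]
      have h1 := real_inner_le_norm (f' (x + t • (y - x)) - f' x) (y - x)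
      have h2 := hB (x + t • (y - x)) x
      rw [add_sub_cancel_left, norm_smul, Real.norm_of_nonneg ht.1.le] at h2
      nlinarith [mul_le_mul_of_nonneg_right h2 (norm_nonneg (y - x))])
  have := hanti (Set.left_mem_Icc.2 zero_le_one) (Set.right_mem_Icc.2 zero_le_one) zero_le_one
  simp at this
  linarith

/-- First-order optimality for minimising a convex function plus a differentiable one. -/
theorem sub_le_inner_of_isMinOn_add {c g : E → ℝ} {g' y u : E} {S : Set E}
    (hS : Convex ℝ S) (hc : ConvexOn ℝ Set.univ c) (hg : HasGradientAt g g' y)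
    (hy : y ∈ S) (hu : u ∈ S) (hmin : ∀ v ∈ S, c y + g y ≤ c v + g v) :
    c y - c u ≤ ⟪g', u - y⟫ := by
  have hd : HasDerivAt (fun s : ℝ => g (y + s • (u - y))) ⟪g', u - y⟫ 0 :=
    HasGradientAt.hasDerivAt_comp_add_smul (by simpa using hg)
  refine ge_of_tendsto hd.tendsto_slope_zero_right ?_
  filter_upwards [Ioo_mem_nhdsGT (zero_lt_one' ℝ)] with t ht
  have he : y + (0 + t) • (u - y) = (1 - t) • y + t • u := by module
  have h1 := hmin _ (hS hy hu (sub_nonneg.2 ht.2.le) ht.1.le (by ring))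
  have h2 := hc.2 (Set.mem_univ y) (Set.mem_univ u) (sub_nonneg.2 ht.2.le) ht.1.le (by ring)
  simp only [he, zero_smul, add_zero, smul_eq_mul] at h2 ⊢
  rw [le_inv_mul_iff₀ ht.1]
  linarith

end HilbertSpace

section Blocks

variable {N : ℕ} {nd : Fin N → ℕ}

/-- If two points differ only in block `i`, a separable sum changes only in its `i`-th term. -/
theorem sum_block_sub_sum_block {M : Type*} [AddCommGroup M]
    (F : ∀ i : Fin N, EuclideanSpace ℝ (Fin (nd i)) → M) {u v : BlockSpace nd} {i : Fin N}
    (h : ∀ j, j ≠ i → u j = v j) :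
    ∑ j, F j (u j) - ∑ j, F j (v j) = F i (u i) - F i (v i) := by
  rw [← Finset.sum_sub_distrib]
  exact Finset.sum_eq_single i (fun j _ hj => by rw [h j hj, sub_self]) (by simp)

/-- The summands of a convex separable function are convex. -/
theorem ConvexOn.block {f : BlockSpace nd → ℝ}
    {F : ∀ i : Fin N, EuclideanSpace ℝ (Fin (nd i)) → ℝ} (hf : ConvexOn ℝ Set.univ f)
    (hF : ∀ u, f u = ∑ i, F i (u i)) (i : Fin N) :
    ConvexOn ℝ Set.univ (fun u : BlockSpace nd => F i (u i)) := by
  refine ⟨convex_univ, fun u _ v _ a b ha hb hab => ?_⟩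
  let e (x : BlockSpace nd) : BlockSpace nd := WithLp.toLp 2 (Pi.single i (x i))
  have hei (x : BlockSpace nd) : e x i = x i := by simp [e]
  have hej (x : BlockSpace nd) (j : Fin N) (hj : j ≠ i) : e x j = 0 := by simp [e, hj]
  have hval (x : BlockSpace nd) : f (e x) = f 0 + (F i (x i) - F i 0) := by
    have := sum_block_sub_sum_block F (u := e x) (v := 0) (i := i) (fun j hj => by
      rw [hej x j hj]; rfl)
    rw [← hF, ← hF, hei] at this
    have h0 : F i ((0 : BlockSpace nd) i) = F i 0 := rfl
    rw [h0] at this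
    linarith
  have hlin : a • e u + b • e v = e (a • u + b • v) := by
    ext1 j
    by_cases hj : j = i
    · subst hj; simp [hei]
    · simp [hej, hj]
  have h := hf.2 (Set.mem_univ (e u)) (Set.mem_univ (e v)) ha hb hab
  rw [hlin, hval, hval, hval] at h
  simp only [smul_eq_mul] at h ⊢
  have hb' : b = 1 - a := by linarith
  subst hb'
  linarith

theorem inner_block_eq {g u v : BlockSpace nd} {i : Fin N} (h : ∀ j, j ≠ i → u j = v j) :
    ⟪g, u - v⟫ = ⟪g i, u i - v i⟫ := by
  rw [PiLp.inner_apply]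
  exact Finset.sum_eq_single i (fun j _ hj => by simp [h j hj]) (by simp)

end Blocks

set_option maxHeartbeats 1000000 in
/-- Lemma 4.3(iii). -/
theorem spdc_augmented_merit_descent {m N : ℕ} (nd : Fin N → ℕ)
    (Ui : ∀ i : Fin N, Set (EuclideanSpace ℝ (Fin (nd i))))
    (hUi_ne : ∀ i, (Ui i).Nonempty) (hUi_closed : ∀ i, IsClosed (Ui i))
    (hUi_convex : ∀ i, Convex ℝ (Ui i))
    (U : Set (BlockSpace nd)) (hU_def : U = {u : BlockSpace nd | ∀ i, u i ∈ Ui i})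
    (C : Set (EuclideanSpace ℝ (Fin m)))
    (hC_ne : C.Nonempty) (hC_closed : IsClosed C) (hC_convex : Convex ℝ C)
    (hC_cone : ∀ a b : ℝ, 0 ≤ a → 0 ≤ b → ∀ x ∈ C, ∀ y ∈ C, a • x + b • y ∈ C)
    (Cstar : Set (EuclideanSpace ℝ (Fin m)))
    (hCstar : Cstar = {p : EuclideanSpace ℝ (Fin m) | ∀ x ∈ C, 0 ≤ ⟪p, x⟫})
    (proj : EuclideanSpace ℝ (Fin m) → EuclideanSpace ℝ (Fin m))
    (hproj_mem : ∀ x, proj x ∈ Cstar)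
    (hproj_char : ∀ x, ∀ q ∈ Cstar, ⟪q - proj x, x - proj x⟫ ≤ 0)
    (G : BlockSpace nd → ℝ) (G' : BlockSpace nd → BlockSpace nd)
    (hG_grad : ∀ x, HasGradientAt G (G' x) x)
    (hG_convex : ConvexOn ℝ Set.univ G)
    (BG : ℝ) (hBG : ∀ x y, ‖G' x - G' y‖ ≤ BG * ‖x - y‖)
    (Ji : ∀ i : Fin N, EuclideanSpace ℝ (Fin (nd i)) → ℝ)
    (J : BlockSpace nd → ℝ) (hJ_add : ∀ u, J u = ∑ i, Ji i (u i))
    (hJ_convex : ConvexOn ℝ Set.univ J) (hJ_lsc : LowerSemicontinuous J)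
    (Θi : ∀ i : Fin N, EuclideanSpace ℝ (Fin (nd i)) → EuclideanSpace ℝ (Fin m))
    (Θ : BlockSpace nd → EuclideanSpace ℝ (Fin m))
    (hΘ_add : ∀ u, Θ u = ∑ i, Θi i (u i))
    (hΘ_Cconvex : ∀ u v : BlockSpace nd, ∀ α : ℝ, α ∈ Set.Icc (0:ℝ) 1 →
      -(Θ (α • u + (1 - α) • v) - α • Θ u - (1 - α) • Θ v) ∈ C)
    (τ : ℝ) (O : Set (BlockSpace nd)) (hO : IsOpen O) (hUO : U ⊆ O)
    (hΘ_lip : ∀ u ∈ O, ∀ v ∈ O, ‖Θ u - Θ v‖ ≤ τ * ‖u - v‖)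
    (γ : ℝ) (hγ : 0 < γ)
    (K : BlockSpace nd → ℝ) (K' : BlockSpace nd → BlockSpace nd)
    (hK_grad : ∀ x, HasGradientAt K (K' x) x)
    (Ki : ∀ i : Fin N, EuclideanSpace ℝ (Fin (nd i)) → ℝ)
    (hK_add : ∀ u, K u = ∑ i, Ki i (u i))
    (β : ℝ) (hβ : 0 < β)
    (hK_strong : ∀ x y : BlockSpace nd,
      K x + ⟪K' x, y - x⟫ + β / 2 * ‖y - x‖ ^ 2 ≤ K y)
    (D : BlockSpace nd → BlockSpace nd → ℝ)
    (hD : ∀ u v, D u v = K u - K v - ⟪K' v, u - v⟫)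
    (L : BlockSpace nd → EuclideanSpace ℝ (Fin m) → ℝ)
    (hL : ∀ u p, L u p = G u + J u + ⟪p, Θ u⟫)
    (Lγ : BlockSpace nd → EuclideanSpace ℝ (Fin m) → ℝ)
    (hLγ : ∀ u p, Lγ u p =
      G u + J u + (‖proj (p + γ • Θ u)‖ ^ 2 - ‖p‖ ^ 2) / (2 * γ))
    (ustar : BlockSpace nd) (pstar : EuclideanSpace ℝ (Fin m))
    (hustar : ustar ∈ U) (hpstar : pstar ∈ Cstar)
    (hsaddle : (∀ p ∈ Cstar, L ustar p ≤ L ustar pstar) ∧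
      (∀ u ∈ U, L ustar pstar ≤ L u pstar))
    (μ : ℝ) (hμpstar : ‖pstar‖ ≤ μ)
    (uk : BlockSpace nd) (huk : uk ∈ U)
    (pk : EuclideanSpace ℝ (Fin m)) (hpk : pk ∈ Cstar) (hpkμ : ‖pk‖ ≤ μ)
    (qk : EuclideanSpace ℝ (Fin m)) (hqk : qk = proj (pk + γ • Θ uk))
    (ε0 εk εk1 : ℝ) (hεk1 : 0 < εk1) (hεk1k : εk1 ≤ εk) (hεk0 : εk ≤ ε0)
    (hε0 : ε0 < N * β / (N * BG + γ * τ ^ 2))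
    (u1 : Fin N → BlockSpace nd) (hu1_mem : ∀ i, u1 i ∈ U)
    (hu1_fix : ∀ i j, j ≠ i → u1 i j = uk j)
    (hu1_min : ∀ i, ∀ u ∈ U,
      ⟪G' uk i, u1 i i⟫ + Ji i (u1 i i) + ⟪qk, Θi i (u1 i i)⟫ + D (u1 i) uk / εk ≤
        ⟪G' uk i, u i⟫ + Ji i (u i) + ⟪qk, Θi i (u i)⟫ + D u uk / εk)
    (p1 : Fin N → EuclideanSpace ℝ (Fin m))
    (hp1 : ∀ i, p1 i =
      min 1 (μ / ‖proj (pk + γ • Θ (u1 i))‖) • proj (pk + γ • Θ (u1 i)))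
    (Λ : ℝ → BlockSpace nd → EuclideanSpace ℝ (Fin m) → ℝ)
    (hΛ : ∀ ε u p, Λ ε u p =
      D ustar u + ε / (2 * γ * N) * ‖pstar - p‖ ^ 2
        + ε * (L u pstar - L ustar pstar))
    (rk : BlockSpace nd) (hrk : ∀ v, J uk + ⟪rk, v - uk⟫ ≤ J v)
    (h₁ : ℝ)
    (hh₁ : h₁ = 2 * τ / β * (‖qk - pstar‖ + ‖pstar - pk‖ / N) *
      (‖G' uk‖ + ‖rk‖ + τ * ‖qk‖)) :
    εk / N * (Lγ uk pstar - Lγ ustar pstar) ≤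
      Λ εk uk pk - 1 / N * ∑ i, Λ εk1 (u1 i) (p1 i)
        + εk / (γ * N) * ‖qk - pk‖ ^ 2
        + ε0 * γ * τ ^ 2 / N * (1 / N * ∑ i, ‖uk - u1 i‖ ^ 2)
        + h₁ * εk ^ 2 := by
  have hεk : 0 < εk := hεk1.trans_le hεk1k
  have hε0pos : 0 < ε0 := hεk.trans_le hεk0
  have hN : (0 : ℝ) < N := by
    rcases Nat.eq_zero_or_pos N with h | h
    · subst h; simp at hε0; linarith
    · exact_mod_cast h
  have hN1 : (1 : ℝ) ≤ N := by exact_mod_cast Nat.one_le_iff_ne_zero.2 (by rintro rfl; simp at hN)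
  have hstep : 0 ≤ β - εk * BG := by
    have hden : 0 < N * BG + γ * τ ^ 2 := by
      by_contra! h
      linarith [div_nonpos_of_nonneg_of_nonpos (mul_pos hN hβ).le h]
    rw [lt_div_iff₀ hden] at hε0
    have h1 : εk * (N * BG + γ * τ ^ 2) ≤ ε0 * (N * BG + γ * τ ^ 2) := by gcongr
    have h2 : 0 ≤ εk * (γ * τ ^ 2) := by positivity
    by_contra! h
    nlinarith
  have hUconv : Convex ℝ U := by
    rw [hU_def]
    intro u hu v hv a b ha hb hab i
    exact hUi_convex i (hu i) (hv i) ha hb hab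
  have hqmem : qk ∈ Cstar := hqk ▸ hproj_mem _
  have hzero_mem : (0 : EuclideanSpace ℝ (Fin m)) ∈ Cstar := by rw [hCstar]; simp
  have hadd_mem : ∀ p ∈ Cstar, ∀ q ∈ Cstar, p + q ∈ Cstar := by
    rw [hCstar]
    intro p hp q hq x hx
    rw [inner_add_left]
    exact add_nonneg (hp x hx) (hq x hx)
  have hΘstar : ∀ q ∈ Cstar, ⟪q, Θ ustar⟫ ≤ 0 := by
    intro q hq
    have := hsaddle.1 _ (hadd_mem q hq pstar hpstar)
    rw [hL, hL, inner_add_left] at this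
    linarith
  have hΘstar0 : ⟪pstar, Θ ustar⟫ = 0 := by
    refine le_antisymm (hΘstar _ hpstar) ?_
    have := hsaddle.1 _ hzero_mem
    rw [hL, hL, inner_zero_left] at this
    linarith
  have hΘsep : ∀ u, ⟪qk, Θ u⟫ = ∑ i, ⟪qk, Θi i (u i)⟫ := by
    intro u
    rw [hΘ_add, inner_sum]
  have hqΘ : ConvexOn ℝ Set.univ (fun u => ⟪qk, Θ u⟫) := by
    refine ⟨convex_univ, fun u _ v _ a b ha hb hab => ?_⟩
    obtain rfl : b = 1 - a := by linarith
    have h := hΘ_Cconvex u v a ⟨ha, by linarith⟩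
    rw [hCstar] at hqmem
    have := hqmem _ h
    rw [inner_neg_right, inner_sub_right, inner_sub_right, inner_smul_right,
      inner_smul_right] at this
    simp only [smul_eq_mul]
    linarith
  have hVI : ∀ i, ∀ v ∈ U,
      εk * (⟪G' uk i, u1 i i⟫ + Ji i (u1 i i) + ⟪qk, Θi i (u1 i i)⟫
        - (⟪G' uk i, v i⟫ + Ji i (v i) + ⟪qk, Θi i (v i)⟫))
        ≤ ⟪K' (u1 i) - K' uk, v - u1 i⟫ := by
    intro i v hv
    have hc : ConvexOn ℝ Set.univ (fun u : BlockSpace nd =>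
        εk * (⟪G' uk i, u i⟫ + Ji i (u i) + ⟪qk, Θi i (u i)⟫) - ⟪K' uk, u⟫) := by
      have hJb := hJ_convex.block hJ_add i
      have hΘb := hqΘ.block (F := fun i w => ⟪qk, Θi i w⟫) hΘsep i
      refine ⟨convex_univ, fun u hu v hv a b ha hb hab => ?_⟩
      have h1 := hJb.2 hu hv ha hb hab
      have h2 := hΘb.2 hu hv ha hb hab
      simp only [PiLp.add_apply, PiLp.smul_apply, smul_eq_mul, inner_add_right,
        inner_smul_right] at h1 h2 ⊢
      nlinarith [mul_le_mul_of_nonneg_left (add_le_add h1 h2) hεk.le]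
    have h := sub_le_inner_of_isMinOn_add hUconv hc (hK_grad (u1 i)) (hu1_mem i) hv (by
      intro w hw
      have := mul_le_mul_of_nonneg_left (hu1_min i w hw) hεk.le
      rw [mul_add, mul_add _ _ (D w uk / εk), mul_div_cancel₀ _ hεk.ne',
        mul_div_cancel₀ _ hεk.ne', hD, hD, inner_sub_right, inner_sub_right] at this
      linarith)
    rw [inner_sub_left, inner_sub_right (K' uk)]
    linarith
  have hmono : ∀ i, ⟪K' (u1 i) - K' uk, uk - u1 i⟫ ≤ -(β * ‖uk - u1 i‖ ^ 2) := by
    intro i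
    have h1 := hK_strong (u1 i) uk
    have h2 := hK_strong uk (u1 i)
    rw [← neg_sub uk (u1 i), inner_neg_right, norm_neg] at h2
    rw [inner_sub_left]
    linarith
  have hthree : ∀ i, ⟪K' (u1 i) - K' uk, ustar - u1 i⟫
      ≤ D ustar uk - D ustar (u1 i) - β / 2 * ‖uk - u1 i‖ ^ 2 := by
    intro i
    have h2 := hK_strong uk (u1 i)
    rw [norm_sub_rev] at h2
    rw [hD, hD, inner_sub_left]
    simp only [inner_sub_right] at h2 ⊢
    linarith
  have hΘlip : ∀ i, ‖Θ uk - Θ (u1 i)‖ ≤ τ * ‖uk - u1 i‖ := fun i =>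
    hΘ_lip _ (hUO huk) _ (hUO (hu1_mem i))
  have hblock : ∀ i, ⟪G' uk i, uk i⟫ + Ji i (uk i) + ⟪qk, Θi i (uk i)⟫
      - (⟪G' uk i, u1 i i⟫ + Ji i (u1 i i) + ⟪qk, Θi i (u1 i i)⟫)
      = ⟪G' uk, uk - u1 i⟫ + J uk - J (u1 i) + ⟪qk, Θ uk - Θ (u1 i)⟫ := by
    intro i
    have hfix : ∀ j, j ≠ i → uk j = u1 i j := fun j hj => (hu1_fix i j hj).symm
    have hJ := sum_block_sub_sum_block Ji hfix
    rw [← hJ_add, ← hJ_add] at hJ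
    have hT := sum_block_sub_sum_block Θi hfix
    rw [← hΘ_add, ← hΘ_add] at hT
    rw [inner_block_eq hfix, hT]
    simp only [inner_sub_right]
    linarith
  have hcross : ∀ i, εk * (1 + 1 / N) * (‖qk - pstar‖ * (τ * ‖uk - u1 i‖)) ≤ h₁ * εk ^ 2 := by
    intro i
    rcases le_or_gt 0 τ with hτ | hτ
    · have hdist : β * ‖uk - u1 i‖ ≤ εk * (‖G' uk‖ + ‖rk‖ + τ * ‖qk‖) := by
        have h1 := (hVI i uk huk).trans (hmono i)
        have h2 := hblock i
        have h3 := real_inner_le_norm (G' uk) (uk - u1 i)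
        have h4 := real_inner_le_norm qk (Θ uk - Θ (u1 i))
        have h5 := real_inner_le_norm rk (uk - u1 i)
        have h6 := hrk (u1 i)
        have h7 := mul_le_mul_of_nonneg_left (hΘlip i) (norm_nonneg qk)
        rw [← neg_sub uk (u1 i), inner_neg_right] at h6
        have h8 : ⟪G' uk, uk - u1 i⟫ + J uk - J (u1 i) + ⟪qk, Θ uk - Θ (u1 i)⟫
            ≤ (‖G' uk‖ + ‖rk‖ + τ * ‖qk‖) * ‖uk - u1 i‖ := by linarith
        have h9 : β * ‖uk - u1 i‖ ^ 2
            ≤ εk * ((‖G' uk‖ + ‖rk‖ + τ * ‖qk‖) * ‖uk - u1 i‖) := by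
          refine le_trans ?_ (mul_le_mul_of_nonneg_left h8 hεk.le)
          rw [← h2]
          linarith
        rcases (norm_nonneg (uk - u1 i)).eq_or_lt with h0 | h0
        · rw [← h0]; simp; positivity
        · refine le_of_mul_le_mul_right ?_ h0
          linarith
      have hdist' : ‖uk - u1 i‖ ≤ εk * (‖G' uk‖ + ‖rk‖ + τ * ‖qk‖) / β := by
        rw [le_div_iff₀ hβ]; linarith
      have hNinv : 1 + 1 / (N : ℝ) ≤ 2 := by
        have : 1 / (N : ℝ) ≤ 1 := by rw [div_le_one hN]; exact hN1
        linarith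
      calc εk * (1 + 1 / N) * (‖qk - pstar‖ * (τ * ‖uk - u1 i‖))
          ≤ εk * 2 * ((‖qk - pstar‖ + ‖pstar - pk‖ / N)
              * (τ * (εk * (‖G' uk‖ + ‖rk‖ + τ * ‖qk‖) / β))) := by
            gcongr
            exact le_add_of_nonneg_right (by positivity)
        _ = h₁ * εk ^ 2 := by rw [hh₁]; field_simp
    · have hsub : O.Subsingleton := by
        intro a ha b hb
        have h1 := (norm_nonneg _).trans (hΘ_lip a ha b hb)
        by_contra hab
        have h2 : 0 < ‖a - b‖ := norm_pos_iff.2 (sub_ne_zero.2 hab)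
        nlinarith
      have hO1 : O = {uk} := hsub.eq_singleton_of_mem (hUO huk)
      have hspace : Subsingleton (BlockSpace nd) := by
        by_contra h
        rw [not_subsingleton_iff_nontrivial] at h
        exact not_isOpen_singleton uk (hO1 ▸ hO)
      have hG0 : G' uk = 0 := Subsingleton.elim _ _
      have hr0 : rk = 0 := Subsingleton.elim _ _
      have hu0 : uk - u1 i = 0 := Subsingleton.elim _ _
      rw [hh₁, hG0, hr0, hu0]
      have : 0 ≤ 2 * τ ^ 2 / β * (‖qk - pstar‖ + ‖pstar - pk‖ / N) * ‖qk‖ * εk ^ 2 := by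
        positivity
      simp only [norm_zero, mul_zero, zero_add]
      calc (0 : ℝ) ≤ _ := this
        _ = _ := by ring
  have hdual : ∀ i, ‖pstar - p1 i‖ ^ 2 ≤ ‖pstar - qk‖ ^ 2
      + 2 * γ * (‖qk - pstar‖ * (τ * ‖uk - u1 i‖)) + γ ^ 2 * τ ^ 2 * ‖uk - u1 i‖ ^ 2 := by
    intro i
    obtain ⟨w, hw⟩ : ∃ w, w = proj (pk + γ • Θ (u1 i)) := ⟨_, rfl⟩
    have h1 : ‖pstar - p1 i‖ ≤ ‖pstar - w‖ := by
      rw [hp1, ← hw]; exact norm_sub_min_smul_le hμpstar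
    have h2 : ‖qk - w‖ ≤ γ * (τ * ‖uk - u1 i‖) := by
      have := norm_sub_le_of_variational hproj_mem hproj_char
        (pk + γ • Θ uk) (pk + γ • Θ (u1 i))
      rw [add_sub_add_left_eq_sub, ← smul_sub, norm_smul, Real.norm_of_nonneg hγ.le,
        ← hqk, ← hw] at this
      exact this.trans (mul_le_mul_of_nonneg_left (hΘlip i) hγ.le)
    have h3 : ‖pstar - w‖ ≤ ‖qk - pstar‖ + ‖qk - w‖ := by
      rw [norm_sub_rev qk pstar]; exact norm_sub_le_norm_sub_add_norm_sub _ _ _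
    calc ‖pstar - p1 i‖ ^ 2 ≤ (‖qk - pstar‖ + γ * (τ * ‖uk - u1 i‖)) ^ 2 := by
          gcongr; linarith
      _ = _ := by rw [norm_sub_rev pstar]; ring
  have hΛbound : ∀ i,
      εk * (⟪G' uk i, uk i⟫ + Ji i (uk i) + ⟪qk, Θi i (uk i)⟫
        - (⟪G' uk i, ustar i⟫ + Ji i (ustar i) + ⟪qk, Θi i (ustar i)⟫)) + Λ εk1 (u1 i) (p1 i)
        ≤ D ustar uk + εk * (L uk pstar - L ustar pstar) + εk / (2 * γ * N) * ‖pstar - qk‖ ^ 2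
          + h₁ * εk ^ 2 + ε0 * γ * τ ^ 2 / N * ‖uk - u1 i‖ ^ 2 := by
    intro i
    have h1 := (hVI i ustar hustar).trans (hthree i)
    have h2 := congrArg (εk * ·) (hblock i)
    have h3 := le_add_inner_add_of_gradient_lipschitz hG_grad hBG uk (u1 i)
    rw [← neg_sub uk (u1 i), inner_neg_right, norm_neg] at h3
    have h3' := mul_le_mul_of_nonneg_left h3 hεk.le
    have h4 : εk * ⟪qk - pstar, Θ uk - Θ (u1 i)⟫ ≤ εk * (‖qk - pstar‖ * (τ * ‖uk - u1 i‖)) :=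
      mul_le_mul_of_nonneg_left ((real_inner_le_norm _ _).trans
        (mul_le_mul_of_nonneg_left (hΘlip i) (norm_nonneg _))) hεk.le
    have h5 : εk1 * (L (u1 i) pstar - L ustar pstar) ≤ εk * (L (u1 i) pstar - L ustar pstar) :=
      mul_le_mul_of_nonneg_right hεk1k (sub_nonneg.2 (hsaddle.2 _ (hu1_mem i)))
    have h6 : εk1 / (2 * γ * N) * ‖pstar - p1 i‖ ^ 2 ≤ εk / (2 * γ * N) * ‖pstar - qk‖ ^ 2
        + εk * (1 / N) * (‖qk - pstar‖ * (τ * ‖uk - u1 i‖))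
        + εk * γ * τ ^ 2 / N / 2 * ‖uk - u1 i‖ ^ 2 := by
      calc εk1 / (2 * γ * N) * ‖pstar - p1 i‖ ^ 2 ≤ εk / (2 * γ * N) * ‖pstar - p1 i‖ ^ 2 := by
            gcongr
        _ ≤ εk / (2 * γ * N) * _ := mul_le_mul_of_nonneg_left (hdual i) (by positivity)
        _ = _ := by field_simp
    have h7 : εk * γ * τ ^ 2 / N / 2 * ‖uk - u1 i‖ ^ 2 ≤ ε0 * γ * τ ^ 2 / N * ‖uk - u1 i‖ ^ 2 := by
      have : 0 ≤ εk * γ * τ ^ 2 / N := by positivity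
      refine mul_le_mul_of_nonneg_right ((half_le_self this).trans ?_) (sq_nonneg _)
      gcongr
    have h8 := hcross i
    have h9 := mul_nonneg hstep (sq_nonneg ‖uk - u1 i‖)
    rw [hΛ, hL uk, hL (u1 i)] at *
    simp only [inner_sub_left, inner_sub_right] at *
    linarith
  have hsum : G uk + J uk - (G ustar + J ustar) + ⟪qk, Θ uk⟫
      ≤ ∑ i, (⟪G' uk i, uk i⟫ + Ji i (uk i) + ⟪qk, Θi i (uk i)⟫
        - (⟪G' uk i, ustar i⟫ + Ji i (ustar i) + ⟪qk, Θi i (ustar i)⟫)) := by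
    have h1 := hG_convex.inner_gradient_le_sub (hG_grad uk) ustar
    have h2 := hΘstar qk hqmem
    rw [inner_sub_right] at h1
    simp only [Finset.sum_sub_distrib, Finset.sum_add_distrib]
    rw [← hJ_add, ← hJ_add, ← inner_sum, ← inner_sum, ← hΘ_add, ← hΘ_add,
      ← PiLp.inner_apply, ← PiLp.inner_apply]
    linarith
  have hLγstar : Lγ ustar pstar = G ustar + J ustar := by
    have h1 := hproj_char (pstar + γ • Θ ustar) pstar hpstar
    have h2 := hΘstar _ (hproj_mem (pstar + γ • Θ ustar))
    have h3 : pstar - proj (pstar + γ • Θ ustar) = 0 := by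
      rw [← norm_eq_zero, ← sq_eq_zero_iff]
      refine le_antisymm ?_ (sq_nonneg _)
      rw [add_sub_right_comm, inner_add_right, real_inner_self_eq_norm_sq, inner_smul_right,
        inner_sub_left _ _ (Θ ustar), hΘstar0] at h1
      nlinarith
    rw [hLγ, ← sub_eq_zero.1 h3]
    simp
  have hLγk : Lγ uk pstar ≤ G uk + J uk + ⟪qk, Θ uk⟫
      + (‖pstar - pk‖ ^ 2 - ‖pstar - qk‖ ^ 2) / (2 * γ) := by
    obtain ⟨z, hz⟩ : ∃ z, z = proj (pstar + γ • Θ uk) := ⟨_, rfl⟩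
    have h1 := hproj_char (pstar + γ • Θ uk) 0 hzero_mem
    have h2 := hproj_char (pk + γ • Θ uk) z (hz ▸ hproj_mem _)
    have h3 := two_mul_inner_sub_le z qk pk pstar
    rw [← hz] at h1
    rw [← hqk] at h2
    have h4 : ‖z‖ ^ 2 - ‖pstar‖ ^ 2
        ≤ 2 * γ * ⟪qk, Θ uk⟫ + (‖pstar - pk‖ ^ 2 - ‖pstar - qk‖ ^ 2) := by
      rw [norm_sub_sq_real z pstar] at h3
      simp only [zero_sub, inner_neg_left, inner_sub_left, inner_sub_right, inner_add_right,
        inner_smul_right, real_inner_self_eq_norm_sq] at h1 h2 h3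
      linarith
    rw [hLγ, ← hz, add_assoc _ ⟪qk, Θ uk⟫]
    gcongr
    rw [div_le_iff₀ (by positivity), add_mul, div_mul_cancel₀ _ (by positivity)]
    linarith
  have htotal := Finset.sum_le_sum (fun i (_ : i ∈ Finset.univ) => hΛbound i)
  rw [Finset.sum_add_distrib, Finset.sum_add_distrib, ← Finset.mul_sum, ← Finset.mul_sum,
    Finset.sum_const, Finset.card_univ, Fintype.card_fin, nsmul_eq_mul] at htotal
  have hS := mul_le_mul_of_nonneg_left hsum hεk.le
  have hfin : εk * (Lγ uk pstar - Lγ ustar pstar)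
      ≤ N * (Λ εk uk pk + h₁ * εk ^ 2) - ∑ i, Λ εk1 (u1 i) (p1 i)
        + ε0 * γ * τ ^ 2 / N * ∑ i, ‖uk - u1 i‖ ^ 2 := by
    have h1 := mul_le_mul_of_nonneg_left hLγk hεk.le
    rw [hLγstar, hΛ]
    have h2 : εk * ((‖pstar - pk‖ ^ 2 - ‖pstar - qk‖ ^ 2) / (2 * γ))
        = N * (εk / (2 * γ * N) * ‖pstar - pk‖ ^ 2)
          - N * (εk / (2 * γ * N) * ‖pstar - qk‖ ^ 2) := by
      field_simp
    linarith
  have hslack : 0 ≤ εk / (γ * N) * ‖qk - pk‖ ^ 2 := by positivity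
  have hdiv := div_le_div_of_nonneg_right hfin hN.le
  have e1 : εk * (Lγ uk pstar - Lγ ustar pstar) / N
      = εk / N * (Lγ uk pstar - Lγ ustar pstar) := by ring
  have e2 : (N * (Λ εk uk pk + h₁ * εk ^ 2) - ∑ i, Λ εk1 (u1 i) (p1 i)
        + ε0 * γ * τ ^ 2 / N * ∑ i, ‖uk - u1 i‖ ^ 2) / N
      = Λ εk uk pk - 1 / N * ∑ i, Λ εk1 (u1 i) (p1 i)
        + ε0 * γ * τ ^ 2 / N * (1 / N * ∑ i, ‖uk - u1 i‖ ^ 2) + h₁ * εk ^ 2 := by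
    field_simp
    ring
  rw [e1, e2] at hdiv
  linarith
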